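/- Let R = k^⊕2 * k^⊕2, with p and q the images in R of the idempotent (1,0) of the first and second factor respectively, and set z = pq + qp − p − q. Then: (1) z lies in the center of R; (2) R is a free module of rank 4 over the subalgebra generated by z; and (3) every simple left R-module has k-dimension at most 2. -/

import Mathlib

open scoped TensorProduct

/-- A two-element family of types, used to form binary free products. -/
def fam (A B : Type) : Bool → Type
  | true => A
  | false => B

instance famSemiring (A B : Type) [Semiring A] [Semiring B] : ∀ b, Semiring (fam A B b)
  | true => ‹Semiring A›
  | false => ‹Semiring B›

instance famAlgebra (k A B : Type) [CommSemiring k] [Semiring A] [Semiring B]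
    [Algebra k A] [Algebra k B] : ∀ b, Algebra k (fam A B b)
  | true => ‹Algebra k A›
  | false => ‹Algebra k B›

/-- The free product (coproduct in the category of unital associative `k`-algebras)
`A * B` of two `k`-algebras. -/
abbrev FP (k A B : Type) [CommSemiring k] [Semiring A] [Semiring B]
    [Algebra k A] [Algebra k B] : Type :=
  LinearAlgebra.FreeProduct k (fam A B)

/-- The canonical map `A →ₐ[k] A * B`. -/
noncomputable def inl (k A B : Type) [CommSemiring k] [Semiring A] [Semiring B]
    [Algebra k A] [Algebra k B] : A →ₐ[k] FP k A B :=
  LinearAlgebra.FreeProduct.ι k (fam A B) true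

/-- The canonical map `B →ₐ[k] A * B`. -/
noncomputable def inr (k A B : Type) [CommSemiring k] [Semiring A] [Semiring B]
    [Algebra k A] [Algebra k B] : B →ₐ[k] FP k A B :=
  LinearAlgebra.FreeProduct.ι k (fam A B) false

/-- The image `p` of the idempotent `(1,0)` of the first factor of `k^⊕2 * k^⊕2`. -/
noncomputable def pp (k : Type) [Field k] : FP k (Fin 2 → k) (Fin 2 → k) :=
  inl k (Fin 2 → k) (Fin 2 → k) (Pi.single 0 1)

/-- The image `q` of the idempotent `(1,0)` of the second factor of `k^⊕2 * k^⊕2`. -/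
noncomputable def qq (k : Type) [Field k] : FP k (Fin 2 → k) (Fin 2 → k) :=
  inr k (Fin 2 → k) (Fin 2 → k) (Pi.single 0 1)

/-- The element `z = pq + qp - p - q`. -/
noncomputable def zz (k : Type) [Field k] : FP k (Fin 2 → k) (Fin 2 → k) :=
  pp k * qq k + qq k * pp k - pp k - qq k

section IdempotentPair

open Polynomial

/-- The element `pq + qp - p - q`, which commutes with the idempotents `p` and `q`. -/
def pairCenter {A : Type*} [Ring A] (p q : A) : A := p * q + q * p - p - q

theorem mul_pairCenter_left {A : Type*} [Ring A] {p q : A} (hp : p * p = p) :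
    p * pairCenter p q = p * q * p - p := by
  simp only [pairCenter, mul_sub, mul_add, ← mul_assoc, hp]
  abel

theorem pairCenter_mul_left {A : Type*} [Ring A] {p q : A} (hp : p * p = p) :
    pairCenter p q * p = p * q * p - p := by
  simp only [pairCenter, sub_mul, add_mul, mul_assoc, hp]
  abel

theorem pairCenter_comm {A : Type*} [Ring A] (p q : A) : pairCenter p q = pairCenter q p := by
  simp only [pairCenter]
  abel

theorem pairCenter_mem_center {k A : Type*} [Field k] [Ring A] [Algebra k A] {p q : A}
    (hp : p * p = p) (hq : q * q = q) (hgen : Algebra.adjoin k {p, q} = ⊤) :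
    pairCenter p q ∈ Subalgebra.center k A := by
  have h : Algebra.adjoin k {p, q} ≤ Subalgebra.centralizer k {pairCenter p q} := by
    refine Algebra.adjoin_le ?_
    rintro x (rfl | rfl) <;> simp only [SetLike.mem_coe, Subalgebra.mem_centralizer_iff,
      Set.mem_singleton_iff, forall_eq]
    · rw [mul_pairCenter_left hp, pairCenter_mul_left hp]
    · rw [pairCenter_comm, mul_pairCenter_left hq, pairCenter_mul_left hq]
  rw [hgen] at h
  refine Subalgebra.mem_center_iff.2 fun b => ?_
  exact (((Subalgebra.mem_centralizer_iff k).1 (h (Algebra.mem_top (x := b))))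
    _ (Set.mem_singleton _)).symm

/-- A subspace stable under left multiplication by generators is stable under the algebra. -/
theorem smul_mem_of_adjoin_eq_top {k A M : Type*} [Field k] [Ring A] [Algebra k A]
    [AddCommGroup M] [Module A M] [Module k M] [IsScalarTower k A M] {s : Set A}
    (hgen : Algebra.adjoin k s = ⊤) (N : Submodule k M)
    (hN : ∀ a ∈ s, ∀ x ∈ N, a • x ∈ N) (a : A) {x : M} (hx : x ∈ N) : a • x ∈ N := by
  have ha : a ∈ Algebra.adjoin k s := hgen ▸ Algebra.mem_top
  induction ha using Algebra.adjoin_induction generalizing x with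
  | mem a ha => exact hN a ha x hx
  | algebraMap r => rw [algebraMap_smul]; exact N.smul_mem r hx
  | add a b _ _ iha ihb => rw [add_smul]; exact N.add_mem (iha hx) (ihb hx)
  | mul a b _ _ iha ihb => rw [mul_smul]; exact iha (ihb hx)

theorem exists_eq_sum_aeval_pairCenter {k A : Type*} [Field k] [Ring A] [Algebra k A] {p q : A}
    (hp : p * p = p) (hq : q * q = q) (hgen : Algebra.adjoin k {p, q} = ⊤) (y : A) :
    ∃ P : Fin 4 → k[X],
      y = ∑ i, aeval (pairCenter p q) (P i) * (![1, p, q, p * q] : Fin 4 → A) i := by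
  let L : (Fin 4 → k[X]) →ₗ[k] A :=
    ∑ i, (LinearMap.mulRight k ((![1, p, q, p * q] : Fin 4 → A) i)) ∘ₗ
      (aeval (pairCenter p q)).toLinearMap ∘ₗ LinearMap.proj i
  have hL : ∀ P, L P = aeval (pairCenter p q) (P 0) + aeval (pairCenter p q) (P 1) * p
      + aeval (pairCenter p q) (P 2) * q + aeval (pairCenter p q) (P 3) * (p * q) := by
    intro P
    simp [L, Fin.sum_univ_four, mul_assoc]
  have hcen := Subalgebra.mem_center_iff.1 (pairCenter_mem_center hp hq hgen)
  have hc : ∀ (P : k[X]) (b : A), b * aeval (pairCenter p q) P = aeval (pairCenter p q) P * b := by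
    intro P b
    have : aeval (pairCenter p q) P ∈ Subalgebra.center k A :=
      (Algebra.adjoin_le (Set.singleton_subset_iff.2 (pairCenter_mem_center hp hq hgen)))
        (aeval_mem_adjoin_singleton k _)
    exact Subalgebra.mem_center_iff.1 this b
  have hqp : q * p = pairCenter p q + p + q - p * q := by
    simp only [pairCenter]; abel
  have hqpq : q * (p * q) = pairCenter p q * q + q := by
    rw [pairCenter_comm, pairCenter_mul_left hq, ← mul_assoc]; abel
  have hpc : ∀ (P : k[X]) (a b : A), a * (aeval (pairCenter p q) P * b)
      = aeval (pairCenter p q) P * (a * b) := by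
    intro P a b
    rw [← mul_assoc, hc, mul_assoc]
  have key : y • (1 : A) ∈ LinearMap.range L := by
    refine smul_mem_of_adjoin_eq_top hgen _ ?_ y ⟨![1, 0, 0, 0], by simp [hL]⟩
    rintro a (rfl | rfl) x ⟨P, rfl⟩
    · refine ⟨![0, P 0 + P 1, 0, P 2 + P 3], ?_⟩
      have hppq : a * (a * q) = a * q := by rw [← mul_assoc, hp]
      rw [hL, hL]
      simp only [smul_eq_mul, mul_add, hpc, hp, hppq, hc _ a]
      simp [add_mul]
      abel
    · refine ⟨![X * P 1, P 1, P 0 + P 1 + P 2 + P 3 + X * P 3, - P 1], ?_⟩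
      have hzP : ∀ (P : k[X]) (b : A), aeval (pairCenter p a) P * (pairCenter p a * b) =
          pairCenter p a * (aeval (pairCenter p a) P * b) := fun P b => by
        rw [← mul_assoc, hcen, mul_assoc]
      rw [hL, hL]
      simp only [smul_eq_mul, mul_add, hpc, hqp, hqpq, hq, hc _ a]
      simp [add_mul, mul_add, mul_sub, mul_assoc, hcen, hzP]
      abel
  obtain ⟨P, hP⟩ := key
  refine ⟨P, ?_⟩
  rw [smul_eq_mul, mul_one, hL] at hP
  rw [← hP, Fin.sum_univ_four]
  simp

/-- The first idempotent of the generic representation in `2 × 2` matrices over `k[X]`. -/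
noncomputable def genericP (k : Type*) [Field k] : Matrix (Fin 2) (Fin 2) k[X] := !![1, 0; 0, 0]

/-- The second idempotent of the generic representation in `2 × 2` matrices over `k[X]`. -/
noncomputable def genericQ (k : Type*) [Field k] : Matrix (Fin 2) (Fin 2) k[X] :=
  !![X + 1, X + 1; -X, -X]

theorem genericP_mul_self (k : Type*) [Field k] : genericP k * genericP k = genericP k := by
  refine Matrix.ext fun i j => ?_
  fin_cases i <;> fin_cases j <;> simp [genericP, Matrix.mul_apply]

theorem genericQ_mul_self (k : Type*) [Field k] : genericQ k * genericQ k = genericQ k := by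
  refine Matrix.ext fun i j => ?_
  fin_cases i <;> fin_cases j <;> simp [genericQ, Matrix.mul_apply] <;> ring

theorem pairCenter_generic (k : Type*) [Field k] :
    pairCenter (genericP k) (genericQ k) = algebraMap k[X] _ X := by
  refine Matrix.ext fun i j => ?_
  fin_cases i <;> fin_cases j <;>
    simp [genericQ, genericP, pairCenter, Matrix.algebraMap_matrix_apply]
  ring

theorem eq_of_sum_aeval_eq {k A : Type*} [Field k] [Ring A] [Algebra k A] {p q : A}
    (φ : A →ₐ[k] Matrix (Fin 2) (Fin 2) k[X]) (hφp : φ p = genericP k) (hφq : φ q = genericQ k)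
    {P Q : Fin 4 → k[X]}
    (h : ∑ i, aeval (pairCenter p q) (P i) * (![1, p, q, p * q] : Fin 4 → A) i =
      ∑ i, aeval (pairCenter p q) (Q i) * (![1, p, q, p * q] : Fin 4 → A) i) : P = Q := by
  have hz : φ (pairCenter p q) = algebraMap k[X] _ X := by
    rw [← pairCenter_generic, ← hφp, ← hφq]
    simp [pairCenter]
  have ha : ∀ R : k[X], φ (aeval (pairCenter p q) R) = algebraMap k[X] _ R := by
    intro R
    rw [← aeval_algHom_apply, hz, aeval_algebraMap_apply, aeval_X_left_apply]
  have hφ : ∀ R : Fin 4 → k[X],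
      φ (∑ i, aeval (pairCenter p q) (R i) * (![1, p, q, p * q] : Fin 4 → A) i) =
        !![R 0 + R 1 + (R 2 + R 3) * (X + 1), (R 2 + R 3) * (X + 1);
          -(R 2 * X), R 0 - R 2 * X] := by
    intro R
    simp only [Fin.sum_univ_four, map_add, map_mul, ha]
    refine Matrix.ext fun i j => ?_
    fin_cases i <;> fin_cases j <;>
      simp [hφp, hφq, genericP, genericQ, Matrix.algebraMap_matrix_apply, Matrix.mul_apply] <;> ring
  have h' := congrArg φ h
  rw [hφ, hφ] at h'
  have e00 := congrFun (congrFun h' 0) 0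
  have e01 := congrFun (congrFun h' 0) 1
  have e10 := congrFun (congrFun h' 1) 0
  have e11 := congrFun (congrFun h' 1) 1
  simp only [Matrix.of_apply, Matrix.cons_val_zero, Matrix.cons_val_one, neg_inj] at e00 e01 e10 e11
  have hX1 : (X + 1 : k[X]) ≠ 0 := by simpa using X_add_C_ne_zero (1 : k)
  have h2 := mul_right_cancel₀ X_ne_zero e10
  have h3 := mul_right_cancel₀ hX1 e01
  have h0 : P 0 = Q 0 := by rw [h2] at e11; exact sub_left_injective e11
  funext i
  fin_cases i
  · exact h0
  · rw [h3, h0] at e00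
    exact add_left_cancel (add_right_cancel e00)
  · exact h2
  · rw [h2] at h3
    exact add_left_cancel h3

theorem existsUnique_coord {k A : Type*} [Field k] [Ring A] [Algebra k A] {p q : A}
    (hp : p * p = p) (hq : q * q = q) (hgen : Algebra.adjoin k {p, q} = ⊤)
    (φ : A →ₐ[k] Matrix (Fin 2) (Fin 2) k[X]) (hφp : φ p = genericP k) (hφq : φ q = genericQ k)
    (y : A) :
    ∃! c : Fin 4 → Algebra.adjoin k {pairCenter p q},
      y = ∑ i, (c i : A) * (![1, p, q, p * q] : Fin 4 → A) i := by
  obtain ⟨P, hP⟩ := exists_eq_sum_aeval_pairCenter hp hq hgen y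
  refine ⟨fun i => ⟨aeval _ (P i), aeval_mem_adjoin_singleton k _⟩, hP, fun c hc => ?_⟩
  have : ∀ i, ∃ Q : k[X], aeval (pairCenter p q) Q = (c i : A) := by
    intro i
    have := (c i).2
    exact (Algebra.adjoin_singleton_eq_range_aeval k (pairCenter p q)).le this
  choose Q hQ using this
  have hPQ : P = Q := eq_of_sum_aeval_eq φ hφp hφq (by simp only [hQ]; rw [← hP]; exact hc)
  ext i
  simp [hPQ, hQ]

theorem exists_smul_eq_of_isSimpleModule {k A M : Type*} [Field k] [IsAlgClosed k] [Ring A]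
    [Algebra k A] {p q : A} (hp : p * p = p) (hq : q * q = q)
    (hgen : Algebra.adjoin k {p, q} = ⊤) [AddCommGroup M] [Module A M] [Module k M]
    [IsScalarTower k A M] [IsSimpleModule A M] :
    ∃ r : k, ∀ x : M, pairCenter p q • x = r • x := by
  have : SMulCommClass A k M := IsScalarTower.to_smulCommClass'
  have hcen := Subalgebra.mem_center_iff.1 (pairCenter_mem_center hp hq hgen)
  set z := pairCenter p q
  let f : Module.End k M := Algebra.lsmul k k M z
  suffices h : ∃ r, r ∈ spectrum k f by
    obtain ⟨r, hr⟩ := h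
    refine ⟨r, ?_⟩
    let g : M →ₗ[A] M :=
      { toFun := fun x => r • x - z • x
        map_add' := fun x y => by simp only [smul_add]; abel
        map_smul' := fun a x => by
          simp only [RingHom.id_apply, smul_sub, smul_comm a r x, ← mul_smul, hcen a] }
    rcases LinearMap.bijective_or_eq_zero g with h | h
    · refine absurd ?_ (spectrum.mem_iff.1 hr)
      rw [Module.End.isUnit_iff]
      exact h
    · intro x
      exact (sub_eq_zero.1 (LinearMap.congr_fun h x)).symm
  by_contra! hspec
  have h0 : Function.Bijective f := by
    have := spectrum.notMem_iff.1 (hspec 0)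
    rw [map_zero, zero_sub, IsUnit.neg_iff, Module.End.isUnit_iff] at this
    exact this
  have : Nontrivial M := IsSimpleModule.nontrivial A M
  obtain ⟨m, hm⟩ := exists_ne (0 : M)
  let e := Module.AEval'.of f
  have hfg : (⊤ : Submodule k[X] (Module.AEval' f)).FG := by
    have : Submodule.span k[X]
        (Set.range fun i => e ((![1, p, q, p * q] : Fin 4 → A) i • m)) = ⊤ := by
      refine eq_top_iff.2 fun x _ => ?_
      obtain ⟨x, rfl⟩ := e.surjective x
      obtain ⟨y, rfl⟩ := IsSimpleModule.toSpanSingleton_surjective A hm x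
      obtain ⟨P, hP⟩ := exists_eq_sum_aeval_pairCenter hp hq hgen y
      have : e (y • m) = ∑ i, P i • e ((![1, p, q, p * q] : Fin 4 → A) i • m) := by
        rw [hP, Finset.sum_smul, map_sum]
        refine Finset.sum_congr rfl fun i _ => ?_
        rw [← Module.AEval.of_aeval_smul, mul_smul]
        congr 1
        change _ = aeval f (P i) _
        rw [aeval_algHom_apply]
        rfl
      rw [LinearMap.toSpanSingleton_apply, this]
      exact Submodule.sum_mem _ fun i _ =>
        Submodule.smul_mem _ _ (Submodule.subset_span ⟨i, rfl⟩)
    rw [← this]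
    exact Submodule.fg_span (Set.finite_range _)
  obtain ⟨r, hr1, hr⟩ := Submodule.exists_sub_one_mem_and_smul_eq_zero_of_fg_of_le_smul
    (Ideal.span {(X : k[X])}) ⊤ hfg (by
      intro x _
      obtain ⟨x, rfl⟩ := e.surjective x
      obtain ⟨y, rfl⟩ := h0.2 x
      have : e (f y) = (X : k[X]) • e y := (Module.AEval'.X_smul_of f y).symm
      rw [this]
      exact Submodule.smul_mem_smul (Ideal.mem_span_singleton_self _) trivial)
  have hr0 : r ≠ 0 := by
    rintro rfl
    have := Ideal.mem_span_singleton.1 hr1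
    rw [zero_sub, dvd_neg] at this
    exact not_isUnit_X (isUnit_of_dvd_one this)
  have hfr : aeval f r = 0 := by
    ext x
    have := hr (e x) trivial
    rw [← Module.AEval.of_aeval_smul] at this
    exact e.map_eq_zero_iff.1 this
  have hprod : aeval f (r.roots.map fun a => X - C a).prod = 0 := by
    have := (IsAlgClosed.splits r).eq_prod_roots
    rw [this, map_mul, aeval_C] at hfr
    rw [← Algebra.smul_def] at hfr
    exact (smul_eq_zero.1 hfr).resolve_left (leadingCoeff_ne_zero.2 hr0)
  obtain ⟨a, ha, -⟩ := spectrum.exists_mem_of_not_isUnit_aeval_prod (p := r) (a := f)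
    (by rw [hprod]; exact not_isUnit_zero)
  exact hspec a ha

theorem rank_le_two_of_isSimpleModule {k A M : Type*} [Field k] [IsAlgClosed k] [Ring A]
    [Algebra k A] {p q : A} (hp : p * p = p) (hq : q * q = q)
    (hgen : Algebra.adjoin k {p, q} = ⊤) [AddCommGroup M] [Module A M] [Module k M]
    [IsScalarTower k A M] [IsSimpleModule A M] : Module.rank k M ≤ 2 := by
  have : SMulCommClass A k M := IsScalarTower.to_smulCommClass'
  have : Nontrivial M := IsSimpleModule.nontrivial A M
  obtain ⟨r, hr⟩ := exists_smul_eq_of_isSimpleModule (M := M) hp hq hgen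
  obtain ⟨m, hm, a, b, hpm, hpqm⟩ : ∃ m : M, m ≠ 0 ∧ ∃ a b : k, p • m = a • m ∧
      p • q • m = b • m := by
    by_cases h : ∀ x : M, p • x = 0
    · obtain ⟨m, hm⟩ := exists_ne (0 : M)
      exact ⟨m, hm, 0, 0, by simp [h], by simp [h]⟩
    · push Not at h
      obtain ⟨x, hx⟩ := h
      refine ⟨p • x, hx, 1, r + 1, by rw [one_smul, ← mul_smul, hp], ?_⟩
      have := hr (p • x)
      rw [← mul_smul, pairCenter_mul_left hp, sub_smul, sub_eq_iff_eq_add] at this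
      rw [add_smul, one_smul, ← this]
      simp only [mul_smul]
  let s : Set M := {m, q • m}
  have hspan : Submodule.span k s = ⊤ := by
    refine eq_top_iff.2 fun x _ => ?_
    obtain ⟨y, rfl⟩ := IsSimpleModule.toSpanSingleton_surjective A hm x
    have hms : m ∈ Submodule.span k s := Submodule.subset_span (by simp [s])
    have hqs : q • m ∈ Submodule.span k s := Submodule.subset_span (by simp [s])
    refine smul_mem_of_adjoin_eq_top hgen _ ?_ y hms
    intro c hc x hx
    have : Submodule.span k s ≤ (Submodule.span k s).comap (Algebra.lsmul k k M c) := by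
      refine Submodule.span_le.2 ?_
      rcases hc with rfl | rfl <;> rintro x (rfl | rfl) <;>
        simp only [SetLike.mem_coe, Submodule.mem_comap, Algebra.lsmul_coe]
      · rw [hpm]; exact Submodule.smul_mem _ _ hms
      · rw [hpqm]; exact Submodule.smul_mem _ _ hms
      · exact hqs
      · rw [← mul_smul, hq]; exact hqs
    exact this hx
  calc Module.rank k M = Module.rank k (Submodule.span k s) := by rw [hspan, rank_top]
    _ ≤ Cardinal.mk s := rank_span_le s
    _ ≤ 2 := by
      refine (Cardinal.mk_insert_le).trans ?_
      rw [Cardinal.mk_singleton]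
      norm_num

end IdempotentPair

section FreeProduct

variable (k : Type) [Field k]

theorem pp_mul_self : pp k * pp k = pp k := by
  rw [pp, ← map_mul, ← Pi.single_mul, one_mul]

theorem qq_mul_self : qq k * qq k = qq k := by
  rw [qq, ← map_mul, ← Pi.single_mul, one_mul]

/-- The homomorphism out of `k^⊕2` sending `(1,0)` to a given idempotent. -/
def ofIdempotent {A : Type*} [Ring A] [Algebra k A] (e : A) (he : e * e = e) :
    (Fin 2 → k) →ₐ[k] A :=
  AlgHom.ofLinearMap
    ((LinearMap.proj 0).smulRight e + (LinearMap.proj 1).smulRight (1 - e))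
    (by simp)
    (by
      intro x y
      simp only [LinearMap.add_apply, LinearMap.smulRight_apply, LinearMap.proj_apply,
        Pi.mul_apply, mul_add, add_mul, smul_mul_smul_comm, mul_sub, sub_mul, he, mul_one, one_mul,
        sub_self, sub_zero, smul_zero, add_zero, zero_add])

theorem ofIdempotent_single {A : Type*} [Ring A] [Algebra k A] (e : A) (he : e * e = e) :
    ofIdempotent k e he (Pi.single 0 1) = e := by
  change (Pi.single 0 1 : Fin 2 → k) 0 • e + (Pi.single 0 1 : Fin 2 → k) 1 • (1 - e) = e
  simp

theorem algHom_ext_single {A : Type*} [Ring A] [Algebra k A] {f g : (Fin 2 → k) →ₐ[k] A}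
    (h : f (Pi.single 0 1) = g (Pi.single 0 1)) : f = g := by
  have h1 : (Pi.single 1 1 : Fin 2 → k) = 1 - Pi.single 0 1 := by
    ext i; fin_cases i <;> simp
  refine AlgHom.toLinearMap_injective (LinearMap.pi_ext' fun i => LinearMap.ext_ring ?_)
  fin_cases i
  · simpa using h
  · simp [h1, h]

theorem exists_lift {A : Type} [Ring A] [Algebra k A] (a b : (Fin 2 → k) →ₐ[k] A) :
    ∃ φ : FP k (Fin 2 → k) (Fin 2 → k) →ₐ[k] A,
      (∀ x, φ (inl k _ _ x) = a x) ∧ ∀ x, φ (inr k _ _ x) = b x := by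
  let maps : {i : Bool} → fam (Fin 2 → k) (Fin 2 → k) i →ₐ[k] A :=
    fun {i} => match i with
      | true => a
      | false => b
  refine ⟨LinearAlgebra.FreeProduct.lift k _ maps, fun x => ?_, fun x => ?_⟩
  · exact AlgHom.congr_fun (LinearAlgebra.FreeProduct.lift_comp_ι k (fam _ _)
      (i := true) maps) x
  · exact AlgHom.congr_fun (LinearAlgebra.FreeProduct.lift_comp_ι k (fam _ _)
      (i := false) maps) x

theorem freeProduct_hom_ext {A : Type} [Ring A] [Algebra k A]
    {f g : FP k (Fin 2 → k) (Fin 2 → k) →ₐ[k] A} (hp : f (pp k) = g (pp k))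
    (hq : f (qq k) = g (qq k)) : f = g := by
  refine (LinearAlgebra.FreeProduct.lift k _).symm.injective ?_
  funext i
  cases i
  · exact algHom_ext_single k (f := f.comp (inr k _ _)) (g := g.comp (inr k _ _)) hq
  · exact algHom_ext_single k (f := f.comp (inl k _ _)) (g := g.comp (inl k _ _)) hp

theorem adjoin_pp_qq : Algebra.adjoin k {pp k, qq k} = ⊤ := by
  set S := Algebra.adjoin k {pp k, qq k}
  have hpS : pp k ∈ S := Algebra.subset_adjoin (by simp)
  have hqS : qq k ∈ S := Algebra.subset_adjoin (by simp)
  obtain ⟨φ, h1, h2⟩ := exists_lift k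
    (ofIdempotent k (⟨pp k, hpS⟩ : S) (Subtype.ext (pp_mul_self k)))
    (ofIdempotent k (⟨qq k, hqS⟩ : S) (Subtype.ext (qq_mul_self k)))
  have : S.val.comp φ = AlgHom.id k _ := by
    refine freeProduct_hom_ext k ?_ ?_
    · simp [pp, h1, ofIdempotent_single]
    · simp [qq, h2, ofIdempotent_single]
  refine eq_top_iff.2 fun x _ => ?_
  rw [← AlgHom.id_apply (R := k) x, ← this]
  exact (φ x).2

theorem exists_generic_representation :
    ∃ φ : FP k (Fin 2 → k) (Fin 2 → k) →ₐ[k] Matrix (Fin 2) (Fin 2) (Polynomial k),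
      φ (pp k) = genericP k ∧ φ (qq k) = genericQ k := by
  obtain ⟨φ, h1, h2⟩ := exists_lift k (ofIdempotent k _ (genericP_mul_self k))
    (ofIdempotent k _ (genericQ_mul_self k))
  exact ⟨φ, by rw [pp, h1, ofIdempotent_single], by rw [qq, h2, ofIdempotent_single]⟩

end FreeProduct

theorem statement12 (k : Type) [Field k] [IsAlgClosed k] [CharZero k] :
    zz k ∈ Subalgebra.center k (FP k (Fin 2 → k) (Fin 2 → k)) ∧
    (∃ v : Fin 4 → FP k (Fin 2 → k) (Fin 2 → k),
      ∀ y : FP k (Fin 2 → k) (Fin 2 → k),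
        ∃! c : Fin 4 → Algebra.adjoin k {zz k},
          y = ∑ i, (c i : FP k (Fin 2 → k) (Fin 2 → k)) * v i) ∧
    ∀ (M : Type) [AddCommGroup M] [Module (FP k (Fin 2 → k) (Fin 2 → k)) M] [Module k M]
      [IsScalarTower k (FP k (Fin 2 → k) (Fin 2 → k)) M],
      IsSimpleModule (FP k (Fin 2 → k) (Fin 2 → k)) M → Module.rank k M ≤ 2 := by
  have hp := pp_mul_self k
  have hq := qq_mul_self k
  have hgen := adjoin_pp_qq k
  obtain ⟨φ, hφp, hφq⟩ := exists_generic_representation k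
  refine ⟨pairCenter_mem_center hp hq hgen,
    ⟨_, existsUnique_coord hp hq hgen φ hφp hφq⟩, ?_⟩
  intro M _ _ _ _ _
  exact rank_le_two_of_isSimpleModule hp hq hgen
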